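/- Let n = 2 and let D be a nonempty bounded open connected subset of ℝ². Let u be continuous on the closure of D, twice continuously differentiable on D, vanishing at every point of ∂D, and suppose Δu is bounded on D with sup_D |Δu| > 0. Then sup_{x∈D} |u(x)| ≤ ( (1/2)·ln π + (1/(2π))·(1 + ln R) ) · ‖Δu‖₁ − (1/(4π)) · ‖Δu‖₁ · ln( ‖Δu‖₁ / ‖Δu‖_∞ ), where R = (|D|/π)^{1/2}. -/

import Mathlib

open MeasureTheory Set Metric Filter

noncomputable section

abbrev Euc2 := EuclideanSpace ℝ (Fin 2)

/-- The Laplacian `Δu(x) = ∑ i, ∂²u/∂x_i²(x)` in dimension 2. -/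
def lapl (u : Euc2 → ℝ) (x : Euc2) : ℝ :=
  ∑ i : Fin 2, fderiv ℝ (fun y => fderiv ℝ u y (EuclideanSpace.single i 1)) x
    (EuclideanSpace.single i 1)

/-! ### The Laplacian -/

lemma lapl_congr {f g : Euc2 → ℝ} {x : Euc2} (h : f =ᶠ[nhds x] g) : lapl f x = lapl g x := by
  refine Finset.sum_congr rfl fun i _ => ?_
  have : (fun y => fderiv ℝ f y (EuclideanSpace.single i 1))
      =ᶠ[nhds x] fun y => fderiv ℝ g y (EuclideanSpace.single i 1) := by
    filter_upwards [h.eventuallyEq_nhds] with y hy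
    rw [hy.fderiv_eq]
  rw [this.fderiv_eq]

lemma lapl_neg (f : Euc2 → ℝ) (x : Euc2) : lapl (fun y => -f y) x = -lapl f x := by
  simp [lapl, fderiv_fun_neg, Finset.sum_neg_distrib]

lemma lapl_comp_add_left (V : Euc2 → ℝ) (x y : Euc2) :
    lapl (fun z => V (x + z)) y = lapl V (x + y) := by
  simp only [lapl, fderiv_comp_add_left]
  refine Finset.sum_congr rfl fun i _ => ?_
  rw [fderiv_comp_add_left (f := fun z => fderiv ℝ V z (EuclideanSpace.single i 1)) x]

lemma measurable_lapl (u : Euc2 → ℝ) : Measurable (lapl u) :=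
  Finset.measurable_sum _ fun _ _ => measurable_fderiv_apply_const ℝ _ _

lemma contDiff_fderiv_single {W : Euc2 → ℝ} {n m : WithTop ℕ∞} (hW : ContDiff ℝ n W)
    (hmn : m + 1 ≤ n) (i : Fin 2) :
    ContDiff ℝ m (fun y => fderiv ℝ W y (EuclideanSpace.single i 1)) :=
  (hW.fderiv_right hmn).clm_apply contDiff_const

lemma continuous_lapl {W : Euc2 → ℝ} (hW : ContDiff ℝ 2 W) : Continuous (lapl W) := by
  unfold lapl
  refine continuous_finsetSum _ fun i _ => ?_
  exact (contDiff_fderiv_single (n := 1) (m := 0)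
    (contDiff_fderiv_single hW (by norm_num) i) (by norm_num) i).continuous

lemma hasCompactSupport_lapl {W : Euc2 → ℝ} (hW : HasCompactSupport W) :
    HasCompactSupport (lapl W) := by
  refine hW.mono' fun x hx => ?_
  by_contra hxs
  refine hx ?_
  rw [lapl_congr (notMem_tsupport_iff_eventuallyEq.1 hxs)]
  simp [lapl]

/-! ### The heat kernel of the plane -/

/-- The heat kernel of `ℝ²` at time `t`. -/
def heatKernel (t : ℝ) (y : Euc2) : ℝ :=
  (4 * Real.pi * t)⁻¹ * Real.exp (-(4 * t)⁻¹ * ‖y‖ ^ 2)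

lemma heatKernel_nonneg {t : ℝ} (ht : 0 ≤ t) (y : Euc2) : 0 ≤ heatKernel t y := by
  unfold heatKernel; positivity

lemma heatKernel_le {t : ℝ} (ht : 0 ≤ t) (y : Euc2) :
    heatKernel t y ≤ (4 * Real.pi * t)⁻¹ := by
  unfold heatKernel
  have h : Real.exp (-(4 * t)⁻¹ * ‖y‖ ^ 2) ≤ 1 := by
    rw [Real.exp_le_one_iff, neg_mul]
    have : 0 ≤ (4 * t)⁻¹ * ‖y‖ ^ 2 := by positivity
    linarith
  exact mul_le_of_le_one_right (by positivity) h

lemma contDiff_heatKernel (t : ℝ) {n : WithTop ℕ∞} : ContDiff ℝ n (heatKernel t) := by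
  unfold heatKernel
  exact contDiff_const.mul (Real.contDiff_exp.comp (contDiff_const.mul (contDiff_norm_sq ℝ)))

lemma continuous_heatKernel (t : ℝ) : Continuous (heatKernel t) :=
  (contDiff_heatKernel t (n := 0)).continuous

lemma measurable_uncurry_heatKernel : Measurable (fun q : ℝ × Euc2 => heatKernel q.1 q.2) := by
  unfold heatKernel
  fun_prop

lemma integral_heatKernel {t : ℝ} (ht : 0 < t) : ∫ y, heatKernel t y = 1 := by
  unfold heatKernel
  rw [integral_const_mul,
    GaussianFourier.integral_rexp_neg_mul_sq_norm (show (0 : ℝ) < (4 * t)⁻¹ by positivity)]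
  have := Real.pi_pos
  simp only [finrank_euclideanSpace, Fintype.card_fin, Nat.cast_ofNat, ne_eq,
    OfNat.ofNat_ne_zero, not_false_eq_true, div_self, Real.rpow_one]
  field_simp

lemma integrable_heatKernel {t : ℝ} (ht : 0 < t) : Integrable (heatKernel t) := by
  by_contra h
  have := integral_heatKernel ht
  rw [integral_undef h] at this
  norm_num at this

lemma heatKernel_sqrt_smul {t : ℝ} (ht : 0 < t) (z : Euc2) :
    heatKernel t (√t • z) = t⁻¹ * heatKernel 1 z := by
  unfold heatKernel
  rw [norm_smul, mul_pow, Real.norm_eq_abs, sq_abs, Real.sq_sqrt ht.le]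
  have h : -(4 * t)⁻¹ * (t * ‖z‖ ^ 2) = -(4 * 1)⁻¹ * ‖z‖ ^ 2 := by
    field_simp
  rw [h]
  have := Real.pi_pos
  field_simp

/-- The heat flow at the origin, rescaled so that it makes sense down to time zero. -/
lemma integral_heatKernel_mul_eq {t : ℝ} (ht : 0 < t) (W : Euc2 → ℝ) :
    ∫ z, heatKernel 1 z * W (√t • z) = ∫ y, heatKernel t y * W y := by
  have h := Measure.integral_comp_smul (volume : Measure Euc2)
    (fun y => heatKernel t y * W y) (√t)
  simp only [heatKernel_sqrt_smul ht, finrank_euclideanSpace, Fintype.card_fin,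
    Real.sq_sqrt ht.le, abs_of_pos (inv_pos.2 ht), smul_eq_mul, mul_assoc,
    integral_const_mul] at h
  exact mul_left_cancel₀ (inv_pos.2 ht).ne' h

/-- The time derivative of the heat kernel, which is also its Laplacian. -/
def heatKernelDeriv (t : ℝ) (y : Euc2) : ℝ :=
  (-t⁻¹ + ‖y‖ ^ 2 / (4 * t ^ 2)) * heatKernel t y

lemma hasDerivAt_heatKernel {t : ℝ} (ht : 0 < t) (y : Euc2) :
    HasDerivAt (fun s => heatKernel s y) (heatKernelDeriv t y) t := by
  unfold heatKernelDeriv heatKernel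
  have hpi := Real.pi_pos
  have h1 : HasDerivAt (fun s : ℝ => (4 * Real.pi * s)⁻¹)
      (-(4 * Real.pi * 1) / (4 * Real.pi * t) ^ 2) t :=
    ((hasDerivAt_id t).const_mul (4 * Real.pi)).inv (by simp [hpi.ne', ht.ne'])
  have h2 : HasDerivAt (fun s : ℝ => (4 * s)⁻¹) (-(4 * 1) / (4 * t) ^ 2) t :=
    ((hasDerivAt_id t).const_mul 4).inv (by simp [ht.ne'])
  refine (h1.mul ((h2.neg.mul_const (‖y‖ ^ 2)).exp)).congr_deriv ?_
  simp only [Pi.neg_apply]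
  field_simp

lemma abs_heatKernelDeriv_le {t : ℝ} (ht : 0 < t) (y : Euc2) :
    |heatKernelDeriv t y| ≤ 2 * t⁻¹ * (4 * Real.pi * t)⁻¹ := by
  have hpi := Real.pi_pos
  set s := (4 * t)⁻¹ * ‖y‖ ^ 2 with hs
  have hs0 : 0 ≤ s := by positivity
  have hE : s * Real.exp (-s) ≤ 1 := by
    rw [Real.exp_neg, ← div_eq_mul_inv, div_le_one (Real.exp_pos s)]
    linarith [Real.add_one_le_exp s]
  have hE1 : Real.exp (-s) ≤ 1 := by rw [Real.exp_le_one_iff]; linarith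
  have h : heatKernelDeriv t y
      = t⁻¹ * (4 * Real.pi * t)⁻¹ * (-Real.exp (-s) + s * Real.exp (-s)) := by
    unfold heatKernelDeriv heatKernel
    rw [neg_mul, ← hs, hs]
    field_simp
  rw [h, abs_mul, abs_of_pos (by positivity : 0 < t⁻¹ * (4 * Real.pi * t)⁻¹)]
  have : |-Real.exp (-s) + s * Real.exp (-s)| ≤ 2 := by
    have := Real.exp_pos (-s)
    have := mul_nonneg hs0 this.le
    rw [abs_le]; constructor <;> linarith
  calc _ ≤ t⁻¹ * (4 * Real.pi * t)⁻¹ * 2 := by gcongr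
    _ = _ := by ring

lemma continuous_heatKernelDeriv (t : ℝ) : Continuous (heatKernelDeriv t) := by
  have := continuous_heatKernel t
  unfold heatKernelDeriv
  fun_prop

lemma fderiv_heatKernel_single {t : ℝ} (i : Fin 2) (y : Euc2) :
    fderiv ℝ (heatKernel t) y (EuclideanSpace.single i 1)
      = -(2 * t)⁻¹ * y i * heatKernel t y := by
  have h : HasFDerivAt (heatKernel t) _ y :=
    (((hasStrictFDerivAt_norm_sq y).hasFDerivAt.const_mul (-(4 * t)⁻¹)).exp).const_mul
      (4 * Real.pi * t)⁻¹
  rw [h.fderiv]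
  simp [heatKernel, EuclideanSpace.inner_single_right]
  ring

lemma lapl_heatKernel {t : ℝ} (ht : 0 < t) (y : Euc2) :
    lapl (heatKernel t) y = heatKernelDeriv t y := by
  have h (i : Fin 2) : fderiv ℝ (fun y => fderiv ℝ (heatKernel t) y (EuclideanSpace.single i 1)) y
      (EuclideanSpace.single i 1) = (-(2 * t)⁻¹ + (2 * t)⁻¹ ^ 2 * y i ^ 2) * heatKernel t y := by
    simp only [fderiv_heatKernel_single]
    have h1 : HasFDerivAt (fun y : Euc2 => -(2 * t)⁻¹ * y i)
        (-(2 * t)⁻¹ • (EuclideanSpace.proj i : Euc2 →L[ℝ] ℝ)) y :=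
      (EuclideanSpace.proj i : Euc2 →L[ℝ] ℝ).hasFDerivAt.const_mul _
    have h2 : HasFDerivAt (heatKernel t) (fderiv ℝ (heatKernel t) y) y :=
      ((contDiff_heatKernel t (n := 1)).differentiable one_ne_zero y).hasFDerivAt
    have h3 : HasFDerivAt (fun y : Euc2 => -(2 * t)⁻¹ * y i * heatKernel t y) _ y := h1.mul h2
    rw [h3.fderiv]
    simp [fderiv_heatKernel_single]
    ring
  unfold lapl
  simp only [h]
  rw [← Finset.sum_mul, Fin.sum_univ_two, heatKernelDeriv, EuclideanSpace.norm_sq_eq,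
    Fin.sum_univ_two]
  simp only [Real.norm_eq_abs, sq_abs]
  field_simp
  ring

/-! ### Duhamel's inequality -/

lemma integral_mul_fderiv_single {f g : Euc2 → ℝ} (hf : ContDiff ℝ 1 f) (hg : ContDiff ℝ 1 g)
    (hgs : HasCompactSupport g) (i : Fin 2) :
    ∫ y, f y * fderiv ℝ g y (EuclideanSpace.single i 1)
      = -∫ y, fderiv ℝ f y (EuclideanSpace.single i 1) * g y := by
  have hf' := (contDiff_fderiv_single (m := 0) hf (by norm_num) i).continuous
  have hg' := (contDiff_fderiv_single (m := 0) hg (by norm_num) i).continuous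
  refine integral_mul_fderiv_eq_neg_fderiv_mul_of_integrable ?_ ?_ ?_
    (fun x _ => hf.differentiable one_ne_zero x) (fun x _ => hg.differentiable one_ne_zero x)
  · exact (hf'.mul hg.continuous).integrable_of_hasCompactSupport hgs.mul_left
  · exact (hf.continuous.mul hg').integrable_of_hasCompactSupport
      (hgs.fderiv_apply ℝ _).mul_left
  · exact (hf.continuous.mul hg.continuous).integrable_of_hasCompactSupport hgs.mul_left

/-- Green's second identity for a compactly supported factor. -/
lemma integral_lapl_mul {f g : Euc2 → ℝ} (hf : ContDiff ℝ 2 f) (hg : ContDiff ℝ 2 g)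
    (hgs : HasCompactSupport g) :
    ∫ y, lapl f y * g y = ∫ y, f y * lapl g y := by
  have e {h : Euc2 → ℝ} (hh : ContDiff ℝ 2 h) (i : Fin 2) :
      ContDiff ℝ 1 (fun y => fderiv ℝ h y (EuclideanSpace.single i 1)) :=
    contDiff_fderiv_single hh (by norm_num) i
  have e' {h : Euc2 → ℝ} (hh : ContDiff ℝ 2 h) (i : Fin 2) :=
    (contDiff_fderiv_single (m := 0) (e hh i) (by norm_num) i).continuous
  unfold lapl
  simp only [Finset.sum_mul, Finset.mul_sum]
  rw [integral_finsetSum, integral_finsetSum]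
  · refine Finset.sum_congr rfl fun i _ => ?_
    rw [integral_mul_fderiv_single (hf.of_le (by norm_num)) (e hg i)
      (hgs.fderiv_apply ℝ _), integral_mul_fderiv_single (e hf i) (hg.of_le (by norm_num)) hgs,
      neg_neg]
  · exact fun i _ => (hf.continuous.mul (e' hg i)).integrable_of_hasCompactSupport
      ((hgs.fderiv_apply ℝ _).fderiv_apply ℝ _).mul_left
  · exact fun i _ => ((e' hf i).mul hg.continuous).integrable_of_hasCompactSupport hgs.mul_left

lemma hasDerivAt_integral_heatKernel {W : Euc2 → ℝ} (hW : ContDiff ℝ 2 W)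
    (hWs : HasCompactSupport W) {t : ℝ} (ht : 0 < t) :
    HasDerivAt (fun s => ∫ y, heatKernel s y * W y) (∫ y, heatKernel t y * lapl W y) t := by
  have hpi := Real.pi_pos
  have hint : Integrable W := hW.continuous.integrable_of_hasCompactSupport hWs
  rw [← integral_lapl_mul (contDiff_heatKernel t) hW hWs]
  simp only [lapl_heatKernel ht]
  refine (hasDerivAt_integral_of_dominated_loc_of_deriv_le
    (bound := fun y => 2 * (t / 2)⁻¹ * (4 * Real.pi * (t / 2))⁻¹ * |W y|)
    (F' := fun s y => heatKernelDeriv s y * W y)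
    (Ioi_mem_nhds (show t / 2 < t by linarith)) ?_ ?_ ?_ ?_ ?_ ?_).2
  · exact Eventually.of_forall fun s =>
      ((continuous_heatKernel s).mul hW.continuous).aestronglyMeasurable
  · exact ((continuous_heatKernel t).mul hW.continuous).integrable_of_hasCompactSupport
      hWs.mul_left
  · exact ((continuous_heatKernelDeriv t).mul hW.continuous).aestronglyMeasurable
  · refine Eventually.of_forall fun y s hs => ?_
    have hs : t / 2 < s := hs
    have hs0 : 0 < s := by linarith
    rw [Real.norm_eq_abs, abs_mul]
    gcongr
    refine (abs_heatKernelDeriv_le hs0 y).trans ?_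
    gcongr
  · exact hint.abs.const_mul _
  · refine Eventually.of_forall fun y s hs => ?_
    have hs : t / 2 < s := hs
    exact (hasDerivAt_heatKernel (by linarith) y).mul_const _

lemma continuous_integral_heatKernel_sqrt_smul {W : Euc2 → ℝ} (hW : Continuous W)
    (hWs : HasCompactSupport W) :
    Continuous fun t : ℝ => ∫ z, heatKernel 1 z * W (√t • z) := by
  obtain ⟨C, hC⟩ := hWs.exists_bound_of_continuous hW
  refine continuous_of_dominated (bound := fun z => heatKernel 1 z * C) (fun t => ?_)
    (fun t => ?_) ((integrable_heatKernel one_pos).mul_const C) ?_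
  · exact ((continuous_heatKernel 1).mul (hW.comp (continuous_const_smul _))).aestronglyMeasurable
  · refine Eventually.of_forall fun z => ?_
    rw [norm_mul, Real.norm_of_nonneg (heatKernel_nonneg zero_le_one z)]
    exact mul_le_mul_of_nonneg_left (hC _) (heatKernel_nonneg zero_le_one z)
  · refine Eventually.of_forall fun z => ?_
    fun_prop

lemma abs_integral_heatKernel_mul_le {g : Euc2 → ℝ} {A : ℝ} (hg : Measurable g)
    (hgA : ∀ y, |g y| ≤ A) {t : ℝ} (ht : 0 < t) :
    Integrable (fun y => heatKernel t y * g y) ∧ |∫ y, heatKernel t y * g y| ≤ A := by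
  have hI : Integrable (fun y => heatKernel t y * A) := (integrable_heatKernel ht).mul_const A
  have hb : ∀ y, ‖heatKernel t y * g y‖ ≤ heatKernel t y * A := fun y => by
    rw [norm_mul, Real.norm_of_nonneg (heatKernel_nonneg ht.le y)]
    exact mul_le_mul_of_nonneg_left (hgA y) (heatKernel_nonneg ht.le y)
  refine ⟨hI.mono' ((continuous_heatKernel t).measurable.mul hg).aestronglyMeasurable
    (Eventually.of_forall hb), ?_⟩
  have := norm_integral_le_of_norm_le hI (Eventually.of_forall hb)
  rwa [integral_mul_const, integral_heatKernel ht, one_mul] at this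

lemma stronglyMeasurable_integral_heatKernel_mul {g : Euc2 → ℝ} (hg : Measurable g) :
    StronglyMeasurable fun t : ℝ => ∫ y, heatKernel t y * g y :=
  StronglyMeasurable.integral_prod_right
    (measurable_uncurry_heatKernel.mul (hg.comp measurable_snd)).stronglyMeasurable

lemma integrableOn_integral_heatKernel_mul {g : Euc2 → ℝ} {A : ℝ} (hg : Measurable g)
    (hgA : ∀ y, |g y| ≤ A) (T : ℝ) :
    IntegrableOn (fun t => ∫ y, heatKernel t y * g y) (Ioc 0 T) := by
  refine Measure.integrableOn_of_bounded (M := A) (by simp)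
    (stronglyMeasurable_integral_heatKernel_mul hg).aestronglyMeasurable ?_
  exact (ae_restrict_iff' measurableSet_Ioc).2 <| Eventually.of_forall fun t ht =>
    (abs_integral_heatKernel_mul_le hg hgA ht.1).2

/-- **Duhamel's inequality** for the heat flow of a function with `-ΔW ≤ g`. -/
lemma le_integral_heatKernel_add {W g : Euc2 → ℝ} {A T : ℝ} (hW : ContDiff ℝ 2 W)
    (hWs : HasCompactSupport W) (hg : Measurable g) (hgA : ∀ y, |g y| ≤ A)
    (hWg : ∀ y, -lapl W y ≤ g y) (hT : 0 < T) :
    W 0 ≤ (∫ y, heatKernel T y * W y) + ∫ t in (0 : ℝ)..T, ∫ y, heatKernel t y * g y := by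
  set H : ℝ → ℝ := fun t => ∫ z, heatKernel 1 z * W (√t • z) with hH
  have hH0 : H 0 = W 0 := by
    simp [hH, integral_mul_const, integral_heatKernel one_pos]
  have hHT : H T = ∫ y, heatKernel T y * W y := integral_heatKernel_mul_eq hT W
  have hderiv : ∀ t ∈ Ioo 0 T,
      HasDerivWithinAt (-H) (-∫ y, heatKernel t y * lapl W y) (Ioi t) t := by
    intro t ht
    refine ((hasDerivAt_integral_heatKernel hW hWs ht.1).congr_of_eventuallyEq
      ?_).neg.hasDerivWithinAt
    filter_upwards [Ioi_mem_nhds ht.1] with s hs using integral_heatKernel_mul_eq hs W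
  have key := intervalIntegral.sub_le_integral_of_hasDeriv_right_of_le hT.le
    (continuous_integral_heatKernel_sqrt_smul hW.continuous hWs).neg.continuousOn hderiv
    ((integrableOn_Icc_iff_integrableOn_Ioc).2 (integrableOn_integral_heatKernel_mul hg hgA T)) ?_
  · simp only [Pi.neg_apply] at key
    linarith
  · intro t ht
    rw [← integral_neg]
    refine integral_mono ?_ (abs_integral_heatKernel_mul_le hg hgA ht.1).1 fun y => ?_
    · exact (((continuous_heatKernel t).mul (continuous_lapl hW)).integrable_of_hasCompactSupport
        (hasCompactSupport_lapl hWs).mul_left).neg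
    · have := mul_le_mul_of_nonneg_left (hWg y) (heatKernel_nonneg ht.1.le y)
      simpa using this

/-! ### Estimates for the heat potential of a bounded integrable function -/

lemma integral_heatKernel_mul_le {g : Euc2 → ℝ} {t : ℝ} (hg0 : ∀ y, 0 ≤ g y)
    (hgi : Integrable g) (ht : 0 < t) :
    ∫ y, heatKernel t y * g y ≤ (4 * Real.pi * t)⁻¹ * ∫ y, g y := by
  rw [← integral_const_mul]
  exact integral_mono_of_nonneg
    (Eventually.of_forall fun y => mul_nonneg (heatKernel_nonneg ht.le y) (hg0 y))
    (hgi.const_mul _)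
    (Eventually.of_forall fun y => mul_le_mul_of_nonneg_right (heatKernel_le ht.le y) (hg0 y))

lemma intervalIntegral_heatKernel_mul_le {g : Euc2 → ℝ} {A M T : ℝ} (hg : Measurable g)
    (hg0 : ∀ y, 0 ≤ g y) (hgA : ∀ y, g y ≤ A) (hgi : Integrable g) (hgM : ∫ y, g y = M)
    (hM : 0 < M) (hA : 0 < A) (hT : M / (4 * Real.pi * A) ≤ T) :
    ∫ t in (0 : ℝ)..T, ∫ y, heatKernel t y * g y
      ≤ M / (4 * Real.pi) * (1 + Real.log (4 * Real.pi * T * A / M)) := by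
  have hpi := Real.pi_pos
  set t₀ := M / (4 * Real.pi * A) with ht₀
  have ht₀pos : 0 < t₀ := by positivity
  have hTpos : 0 < T := ht₀pos.trans_le hT
  have hgA' : ∀ y, |g y| ≤ A := fun y => by rw [abs_of_nonneg (hg0 y)]; exact hgA y
  have hi : IntervalIntegrable (fun t => ∫ y, heatKernel t y * g y) volume 0 T :=
    (intervalIntegrable_iff_integrableOn_Ioc_of_le hTpos.le).2
      (integrableOn_integral_heatKernel_mul hg hgA' T)
  have hi1 : IntervalIntegrable (fun t => ∫ y, heatKernel t y * g y) volume 0 t₀ :=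
    hi.mono_set (by
      rw [uIcc_of_le hTpos.le, uIcc_of_le ht₀pos.le]; exact Icc_subset_Icc_right hT)
  have hi2 : IntervalIntegrable (fun t => ∫ y, heatKernel t y * g y) volume t₀ T :=
    hi.mono_set (by
      rw [uIcc_of_le hTpos.le, uIcc_of_le hT]; exact Icc_subset_Icc_left ht₀pos.le)
  rw [← intervalIntegral.integral_add_adjacent_intervals hi1 hi2]
  have b1 : ∫ t in (0 : ℝ)..t₀, ∫ y, heatKernel t y * g y ≤ M / (4 * Real.pi) := by
    have h := intervalIntegral.integral_mono_on_of_le_Ioo ht₀pos.le hi1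
      (intervalIntegrable_const (c := A)) fun t ht =>
        (le_abs_self _).trans (abs_integral_heatKernel_mul_le hg hgA' ht.1).2
    rw [intervalIntegral.integral_const, sub_zero, smul_eq_mul] at h
    refine h.trans_eq ?_
    rw [ht₀]; field_simp
  have h0 : (0 : ℝ) ∉ uIcc t₀ T := by
    rw [uIcc_of_le hT]; exact fun h => absurd h.1 (not_le.2 ht₀pos)
  have b2 : ∫ t in t₀..T, ∫ y, heatKernel t y * g y
      ≤ M / (4 * Real.pi) * Real.log (4 * Real.pi * T * A / M) := by
    have h := intervalIntegral.integral_mono_on_of_le_Ioo hT hi2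
      (g := fun t => M / (4 * Real.pi) * t⁻¹)
      ((intervalIntegral.intervalIntegrable_inv (fun x hx h => h0 (h ▸ hx))
        continuousOn_id).const_mul _) fun t ht => by
        have ht0 : 0 < t := ht₀pos.trans ht.1
        refine (integral_heatKernel_mul_le hg0 hgi ht0).trans_eq ?_
        rw [hgM]; field_simp
    rw [intervalIntegral.integral_const_mul, integral_inv h0] at h
    refine h.trans_eq ?_
    rw [ht₀]
    congr 2
    field_simp
  linarith

lemma integral_heatKernel_mul_comp_add_nonneg {g : Euc2 → ℝ} (hg0 : ∀ y, 0 ≤ g y) {t : ℝ}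
    (ht : 0 < t) (x : Euc2) : 0 ≤ ∫ y, heatKernel t y * g (x + y) :=
  integral_nonneg fun y => mul_nonneg (heatKernel_nonneg ht.le y) (hg0 _)

/-- The heat flow contracts the `L¹` norm, integrated in time. -/
lemma lintegral_intervalIntegral_heatKernel_le {g : Euc2 → ℝ} {A T : ℝ} (hg : Measurable g)
    (hg0 : ∀ y, 0 ≤ g y) (hgA : ∀ y, g y ≤ A) (hgi : Integrable g) (hT : 0 < T) :
    ∫⁻ x, ENNReal.ofReal (∫ t in (0 : ℝ)..T, ∫ y, heatKernel t y * g (x + y))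
      ≤ ENNReal.ofReal (T * ∫ y, g y) := by
  have hgA' : ∀ y, |g y| ≤ A := fun y => by rw [abs_of_nonneg (hg0 y)]; exact hgA y
  have hgx (x : Euc2) : Measurable fun y => g (x + y) := hg.comp (measurable_const_add x)
  have hpt (x : Euc2) : ENNReal.ofReal (∫ t in (0 : ℝ)..T, ∫ y, heatKernel t y * g (x + y))
      = ∫⁻ t in Ioc 0 T, ∫⁻ y, ENNReal.ofReal (heatKernel t y) * ENNReal.ofReal (g (x + y)) := by
    rw [intervalIntegral.integral_of_le hT.le, ofReal_integral_eq_lintegral_ofReal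
      (integrableOn_integral_heatKernel_mul (hgx x) (fun y => hgA' _) T)]
    · refine setLIntegral_congr_fun measurableSet_Ioc fun t ht => ?_
      rw [ofReal_integral_eq_lintegral_ofReal
        (abs_integral_heatKernel_mul_le (hgx x) (fun y => hgA' _) ht.1).1]
      · simp only [ENNReal.ofReal_mul (heatKernel_nonneg ht.1.le _)]
      · exact Eventually.of_forall fun y => mul_nonneg (heatKernel_nonneg ht.1.le y) (hg0 _)
    · exact (ae_restrict_iff' measurableSet_Ioc).2 <| Eventually.of_forall fun t ht =>
        integral_heatKernel_mul_comp_add_nonneg hg0 ht.1 x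
  have hker : Measurable fun q : ℝ × Euc2 => ENNReal.ofReal (heatKernel q.1 q.2) :=
    measurable_uncurry_heatKernel.ennreal_ofReal
  have hm : Measurable fun q : (Euc2 × ℝ) × Euc2 =>
      ENNReal.ofReal (heatKernel q.1.2 q.2) * ENNReal.ofReal (g (q.1.1 + q.2)) := by
    refine Measurable.mul (hker.comp ((measurable_snd.comp measurable_fst).prodMk measurable_snd))
      (hg.comp ?_).ennreal_ofReal
    fun_prop
  simp only [hpt]
  rw [lintegral_lintegral_swap hm.lintegral_prod_right'.aemeasurable]
  have hin : ∀ t ∈ Ioc 0 T, ∫⁻ x, ∫⁻ y, ENNReal.ofReal (heatKernel t y)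
      * ENNReal.ofReal (g (x + y)) = ENNReal.ofReal (∫ y, g y) := by
    intro t ht
    rw [lintegral_lintegral_swap]
    · have (y : Euc2) : ∫⁻ x, ENNReal.ofReal (heatKernel t y) * ENNReal.ofReal (g (x + y))
          = ENNReal.ofReal (heatKernel t y) * ENNReal.ofReal (∫ y, g y) := by
        rw [lintegral_const_mul _ (by fun_prop),
          lintegral_add_right_eq_self (fun x => ENNReal.ofReal (g x)) y,
          ofReal_integral_eq_lintegral_ofReal hgi (Eventually.of_forall hg0)]
      simp only [this]
      rw [lintegral_mul_const _ (continuous_heatKernel t).measurable.ennreal_ofReal,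
        ← ofReal_integral_eq_lintegral_ofReal (integrable_heatKernel ht.1)
          (Eventually.of_forall (heatKernel_nonneg ht.1.le)), integral_heatKernel ht.1]
      simp
    · have : Measurable fun q : Euc2 × Euc2 => ((q.1, t), q.2) := by fun_prop
      exact (hm.comp this).aemeasurable
  rw [setLIntegral_congr_fun measurableSet_Ioc hin]
  simp [ENNReal.ofReal_mul hT.le, mul_comm]

/-! ### The pointwise bound for compactly supported subsolutions -/

section Subsolution

variable {V g : Euc2 → ℝ} {D : Set Euc2} {A M m : ℝ}

/-- Duhamel's inequality at an arbitrary point, the first term being bounded by `‖V‖₁`. -/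
lemma le_integral_add_heatPotential (hV : ContDiff ℝ 2 V) (hVs : HasCompactSupport V)
    (hV0 : ∀ x, 0 ≤ V x) (hg : Measurable g) (hg0 : ∀ y, 0 ≤ g y) (hgA : ∀ y, g y ≤ A)
    (hVg : ∀ y, -lapl V y ≤ g y) {T : ℝ} (hT : 0 < T) (x : Euc2) :
    V x ≤ (4 * Real.pi * T)⁻¹ * (∫ y, V y)
      + ∫ t in (0 : ℝ)..T, ∫ y, heatKernel t y * g (x + y) := by
  have hs : HasCompactSupport fun y => V (x + y) :=
    hVs.comp_homeomorph (Homeomorph.addLeft x)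
  have h := le_integral_heatKernel_add (W := fun y => V (x + y)) (g := fun y => g (x + y))
    (A := A) (hV.comp (contDiff_const.add contDiff_id)) hs
    (hg.comp (measurable_const_add x))
    (fun y => by rw [abs_of_nonneg (hg0 _)]; exact hgA _)
    (fun y => by rw [lapl_comp_add_left]; exact hVg _) hT
  have h2 := integral_heatKernel_mul_le (g := fun y => V (x + y)) (fun y => hV0 _)
    ((hV.continuous.comp (continuous_const_add x)).integrable_of_hasCompactSupport hs) hT
  rw [integral_add_left_eq_self V x] at h2
  simp only [add_zero] at h
  linarith

lemma integral_le_of_neg_lapl_le (hV : ContDiff ℝ 2 V) (hVs : HasCompactSupport V)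
    (hV0 : ∀ x, 0 ≤ V x) (hVD : ∀ x ∉ D, V x = 0) (hDm : volume D = ENNReal.ofReal m)
    (hm : 0 < m) (hg : Measurable g) (hg0 : ∀ y, 0 ≤ g y)
    (hgA : ∀ y, g y ≤ A) (hgi : Integrable g) (hVg : ∀ y, -lapl V y ≤ g y) :
    ∫ y, V y ≤ m / Real.pi * ∫ y, g y := by
  have hpi := Real.pi_pos
  have hVi : Integrable V := hV.continuous.integrable_of_hasCompactSupport hVs
  set I := ∫ y, V y with hI
  have hI0 : 0 ≤ I := integral_nonneg hV0
  set T := m / (2 * Real.pi) with hT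
  have hTpos : 0 < T := by positivity
  have hM0 : 0 ≤ ∫ y, g y := integral_nonneg hg0
  have hc : (4 * Real.pi * T)⁻¹ = (2 * m)⁻¹ := by
    rw [hT]; congr 1; field_simp; ring
  have key : ENNReal.ofReal I ≤ ENNReal.ofReal (I / 2 + T * ∫ y, g y) := by
    calc ENNReal.ofReal I = ∫⁻ x, ENNReal.ofReal (V x) :=
          ofReal_integral_eq_lintegral_ofReal hVi (Eventually.of_forall hV0)
      _ = ∫⁻ x in D, ENNReal.ofReal (V x) := by
          refine (setLIntegral_eq_of_support_subset ?_).symm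
          intro x hx
          by_contra hxD
          simp [hVD x hxD] at hx
      _ ≤ ∫⁻ x in D, (ENNReal.ofReal ((2 * m)⁻¹ * I) + ENNReal.ofReal
            (∫ t in (0 : ℝ)..T, ∫ y, heatKernel t y * g (x + y))) := by
          refine lintegral_mono fun x => ?_
          refine (ENNReal.ofReal_le_ofReal ?_).trans ENNReal.ofReal_add_le
          rw [← hc]
          exact le_integral_add_heatPotential hV hVs hV0 hg hg0 hgA hVg hTpos x
      _ = ENNReal.ofReal ((2 * m)⁻¹ * I) * volume D + ∫⁻ x in D, ENNReal.ofReal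
            (∫ t in (0 : ℝ)..T, ∫ y, heatKernel t y * g (x + y)) := by
          rw [lintegral_add_left measurable_const, setLIntegral_const]
      _ ≤ ENNReal.ofReal ((2 * m)⁻¹ * I) * volume D + ENNReal.ofReal (T * ∫ y, g y) := by
          gcongr
          exact (setLIntegral_le_lintegral _ _).trans
            (lintegral_intervalIntegral_heatKernel_le hg hg0 hgA hgi hTpos)
      _ = ENNReal.ofReal (I / 2 + T * ∫ y, g y) := by
          rw [hDm, ← ENNReal.ofReal_mul (by positivity),
            ← ENNReal.ofReal_add (by positivity) (by positivity)]
          congr 2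
          field_simp
  have h := (ENNReal.ofReal_le_ofReal_iff (by positivity)).1 key
  have h2 : I ≤ 2 * (T * ∫ y, g y) := by linarith
  refine h2.trans_eq ?_
  rw [hT]; field_simp

lemma le_of_neg_lapl_le (hV : ContDiff ℝ 2 V) (hVs : HasCompactSupport V)
    (hV0 : ∀ x, 0 ≤ V x) (hVD : ∀ x ∉ D, V x = 0) (hDm : volume D = ENNReal.ofReal m)
    (hm : 0 < m) (hg : Measurable g) (hg0 : ∀ y, 0 ≤ g y)
    (hgA : ∀ y, g y ≤ A) (hgi : Integrable g) (hgM : ∫ y, g y = M) (hM : 0 < M) (hA : 0 < A)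
    (hMA : M ≤ A * m) (hVg : ∀ y, -lapl V y ≤ g y) (x : Euc2) :
    V x ≤ M / (4 * Real.pi) * (3 + Real.log (2 * m * A / M)) := by
  have hpi := Real.pi_pos
  set T := m / (2 * Real.pi) with hT
  have hTpos : 0 < T := by positivity
  have h1 := le_integral_add_heatPotential hV hVs hV0 hg hg0 hgA hVg hTpos x
  have h2 := integral_le_of_neg_lapl_le hV hVs hV0 hVD hDm hm hg hg0 hgA hgi hVg
  rw [hgM] at h2
  have h3 := intervalIntegral_heatKernel_mul_le (g := fun y => g (x + y)) (T := T)
    (hg.comp (measurable_const_add x)) (fun y => hg0 _) (fun y => hgA _)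
    (hgi.comp_add_left x) ((integral_add_left_eq_self g x).trans hgM) hM hA (by
      rw [hT, div_le_div_iff₀ (by positivity) (by positivity)]
      nlinarith [mul_pos hpi (mul_pos hA hm), mul_le_mul_of_nonneg_left hMA hpi.le])
  have e1 : 4 * Real.pi * T = 2 * m := by
    rw [hT]; field_simp; ring
  rw [e1] at h1 h3
  have h4 : (2 * m)⁻¹ * ∫ y, V y ≤ M / (4 * Real.pi) * 2 := by
    calc (2 * m)⁻¹ * ∫ y, V y ≤ (2 * m)⁻¹ * (m / Real.pi * M) := by gcongr
      _ = _ := by field_simp; ring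
  linarith

end Subsolution

/-! ### A smooth convex truncation -/

/-- The derivative of `convexTrunc ε`: a smooth monotone transition from `0` to `1`
on `[ε, 2ε]`. -/
def truncSlope (ε t : ℝ) : ℝ := Real.smoothTransition (t / ε - 1)

/-- A smooth convex function which vanishes on `(-∞, ε]` and has slope `1` on `[2ε, ∞)`. -/
def convexTrunc (ε t : ℝ) : ℝ := ∫ s in (0 : ℝ)..t, truncSlope ε s

lemma contDiff_truncSlope (ε : ℝ) : ContDiff ℝ 1 (truncSlope ε) := by
  have h : ContDiff ℝ 1 Real.smoothTransition := Real.smoothTransition.contDiff (n := 1)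
  unfold truncSlope
  exact h.comp ((contDiff_id.div_const ε).sub contDiff_const)

lemma monotone_truncSlope {ε : ℝ} (hε : 0 < ε) : Monotone (truncSlope ε) := fun s t hst =>
  Real.smoothTransition.monotone (by gcongr)

lemma truncSlope_nonneg (ε t : ℝ) : 0 ≤ truncSlope ε t := Real.smoothTransition.nonneg _

lemma truncSlope_le_one (ε t : ℝ) : truncSlope ε t ≤ 1 := Real.smoothTransition.le_one _

lemma hasDerivAt_convexTrunc (ε t : ℝ) : HasDerivAt (convexTrunc ε) (truncSlope ε t) t :=
  intervalIntegral.integral_hasDerivAt_right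
    ((contDiff_truncSlope ε).continuous.intervalIntegrable _ _)
    ((contDiff_truncSlope ε).continuous.stronglyMeasurableAtFilter _ _)
    (contDiff_truncSlope ε).continuous.continuousAt

lemma contDiff_convexTrunc (ε : ℝ) : ContDiff ℝ 2 (convexTrunc ε) := by
  have hd : deriv (convexTrunc ε) = truncSlope ε :=
    funext fun t => (hasDerivAt_convexTrunc ε t).deriv
  rw [show (2 : WithTop ℕ∞) = 1 + 1 by norm_num, contDiff_succ_iff_deriv, hd]
  exact ⟨fun t => (hasDerivAt_convexTrunc ε t).differentiableAt, by simp, contDiff_truncSlope ε⟩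

lemma convexTrunc_eq_zero {ε t : ℝ} (hε : 0 < ε) (ht : t ≤ ε) : convexTrunc ε t = 0 := by
  unfold convexTrunc
  refine (intervalIntegral.integral_congr (g := fun _ => 0) fun s hs => ?_).trans (by simp)
  refine Real.smoothTransition.zero_of_nonpos ?_
  have hs' : s ≤ ε := hs.2.trans (max_le hε.le ht)
  rw [sub_nonpos, div_le_one hε]
  exact hs'

lemma convexTrunc_nonneg {ε : ℝ} (hε : 0 < ε) (t : ℝ) : 0 ≤ convexTrunc ε t := by
  rcases le_total t ε with h | h
  · exact (convexTrunc_eq_zero hε h).ge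
  · exact intervalIntegral.integral_nonneg (hε.le.trans h) fun s _ => truncSlope_nonneg ε s

lemma sub_le_convexTrunc {ε : ℝ} (hε : 0 < ε) (t : ℝ) : t - 2 * ε ≤ convexTrunc ε t := by
  rcases le_total t (2 * ε) with h | h
  · exact (sub_nonpos.2 h).trans (convexTrunc_nonneg hε t)
  · have hi (a b : ℝ) : IntervalIntegrable (truncSlope ε) volume a b :=
      (contDiff_truncSlope ε).continuous.intervalIntegrable _ _
    have h1 : ∫ s in (2 * ε)..t, truncSlope ε s = t - 2 * ε := by
      refine (intervalIntegral.integral_congr (g := fun _ => 1) fun s hs => ?_).trans (by simp)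
      rw [uIcc_of_le h] at hs
      refine Real.smoothTransition.one_of_one_le ?_
      rw [le_sub_iff_add_le, le_div_iff₀ hε]
      linarith [hs.1]
    have h2 : convexTrunc ε t = convexTrunc ε (2 * ε) + (t - 2 * ε) := by
      rw [← h1]
      exact (intervalIntegral.integral_add_adjacent_intervals (hi _ _) (hi _ _)).symm
    linarith [convexTrunc_nonneg hε (2 * ε)]

/-- Kato's inequality for a smooth convex truncation. -/
lemma neg_lapl_convexTrunc_comp_le {u : Euc2 → ℝ} {x : Euc2} {ε : ℝ} (hε : 0 < ε)
    (hu : ContDiffAt ℝ 2 u x) :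
    -lapl (fun y => convexTrunc ε (u y)) x ≤ |lapl u x| := by
  have hnear : ∀ᶠ y in nhds x, DifferentiableAt ℝ u y := by
    filter_upwards [hu.eventually (by simp)] with y hy using hy.differentiableAt (by norm_num)
  have hux : DifferentiableAt ℝ u x := hnear.self_of_nhds
  have h1 (i : Fin 2) : (fun y => fderiv ℝ (fun y => convexTrunc ε (u y)) y
      (EuclideanSpace.single i 1)) =ᶠ[nhds x]
      fun y => truncSlope ε (u y) * fderiv ℝ u y (EuclideanSpace.single i 1) := by
    filter_upwards [hnear] with y hy
    have := (hasDerivAt_convexTrunc ε (u y)).comp_hasFDerivAt y hy.hasFDerivAt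
    rw [show (fun y => convexTrunc ε (u y)) = convexTrunc ε ∘ u from rfl, this.fderiv]
    simp
  have h2 (i : Fin 2) : DifferentiableAt ℝ
      (fun y => fderiv ℝ u y (EuclideanSpace.single i 1)) x :=
    ((hu.fderiv_right (m := 1) (by norm_num)).differentiableAt (by norm_num)).clm_apply
      (differentiableAt_const _)
  have h3 : HasFDerivAt (fun y => truncSlope ε (u y))
      (deriv (truncSlope ε) (u x) • fderiv ℝ u x) x :=
    (((contDiff_truncSlope ε).differentiable one_ne_zero _).hasDerivAt).comp_hasFDerivAt x
      hux.hasFDerivAt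
  have h4 : lapl (fun y => convexTrunc ε (u y)) x = truncSlope ε (u x) * lapl u x
      + deriv (truncSlope ε) (u x)
        * ∑ i : Fin 2, (fderiv ℝ u x (EuclideanSpace.single i 1)) ^ 2 := by
    unfold lapl
    rw [Finset.mul_sum, Finset.mul_sum, ← Finset.sum_add_distrib]
    refine Finset.sum_congr rfl fun i _ => ?_
    rw [(h1 i).fderiv_eq, (h3.fun_mul (h2 i).hasFDerivAt).fderiv]
    simp
    ring
  have h5 : 0 ≤ deriv (truncSlope ε) (u x)
      * ∑ i : Fin 2, (fderiv ℝ u x (EuclideanSpace.single i 1)) ^ 2 :=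
    mul_nonneg (monotone_truncSlope hε).deriv_nonneg (Finset.sum_nonneg fun i _ => sq_nonneg _)
  have h6 : |truncSlope ε (u x) * lapl u x| ≤ |lapl u x| := by
    rw [abs_mul, abs_of_nonneg (truncSlope_nonneg ε (u x))]
    exact mul_le_of_le_one_left (abs_nonneg _) (truncSlope_le_one ε _)
  rw [h4]
  linarith [neg_abs_le (truncSlope ε (u x) * lapl u x)]

/-! ### The bound on a domain -/

section Domain

variable {D : Set Euc2} {u : Euc2 → ℝ} {A M m : ℝ}

/-- One-sided estimate for a function vanishing on the boundary. -/
lemma le_of_abs_lapl_le (hDo : IsOpen D) (hDb : Bornology.IsBounded D)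
    (hu_cont : ContinuousOn u (closure D)) (hu_smooth : ContDiffOn ℝ 2 u D)
    (hu_bdry : ∀ x ∈ frontier D, u x = 0) (hA : ∀ x ∈ D, |lapl u x| ≤ A) (hApos : 0 < A)
    (hM : ∫ x in D, |lapl u x| = M) (hMpos : 0 < M)
    (hDm : volume D = ENNReal.ofReal m) (hm : 0 < m) {x : Euc2} (hx : x ∈ D) :
    u x ≤ M / (4 * Real.pi) * (3 + Real.log (2 * m * A / M)) := by
  set g : Euc2 → ℝ := D.indicator fun y => |lapl u y| with hg
  have hlm : Measurable (lapl u) := measurable_lapl u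
  have hgm : Measurable g := hlm.abs.indicator hDo.measurableSet
  have hg0 : ∀ y, 0 ≤ g y := fun y => indicator_nonneg (fun _ _ => abs_nonneg _) y
  have hgA : ∀ y, g y ≤ A := fun y => indicator_le' hA (fun _ _ => hApos.le) y
  have hDfin : volume D < ⊤ := by rw [hDm]; exact ENNReal.ofReal_lt_top
  have hDint : IntegrableOn (fun y => |lapl u y|) D :=
    Measure.integrableOn_of_bounded (M := A) hDfin.ne hlm.abs.aestronglyMeasurable
      ((ae_restrict_iff' hDo.measurableSet).2 <| Eventually.of_forall fun y hy => by
        rw [Real.norm_eq_abs, abs_abs]; exact hA y hy)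
  have hgi : Integrable g := hDint.integrable_indicator hDo.measurableSet
  have hgM : ∫ y, g y = M := by rw [hg, integral_indicator hDo.measurableSet, hM]
  have hMA : M ≤ A * m := by
    rw [← hM]
    refine (setIntegral_mono_on hDint (integrableOn_const hDfin.ne) hDo.measurableSet hA).trans_eq
      ?_
    rw [setIntegral_const, smul_eq_mul, Measure.real, hDm, ENNReal.toReal_ofReal hm.le, mul_comm]
  refine le_of_forall_pos_le_add fun δ hδ => ?_
  set ε := δ / 2 with hε'
  have hε : 0 < ε := by positivity
  set V : Euc2 → ℝ := D.indicator fun y => convexTrunc ε (u y) with hV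
  set K : Set Euc2 := closure D ∩ u ⁻¹' Ici ε with hK
  have hKc : IsCompact K :=
    hDb.isCompact_closure.of_isClosed_subset
      (hu_cont.preimage_isClosed_of_isClosed isClosed_closure isClosed_Ici) inter_subset_left
  have hKD : K ⊆ D := by
    rintro y ⟨hyc, hyu⟩
    by_contra hyD
    have : u y = 0 := hu_bdry y ⟨hyc, by rwa [hDo.interior_eq]⟩
    have hyu : ε ≤ u y := hyu
    linarith
  have hV0 : ∀ y, y ∉ K → V y = 0 := by
    intro y hy
    by_cases hyD : y ∈ D
    · rw [hV, indicator_of_mem hyD]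
      refine convexTrunc_eq_zero hε (le_of_not_ge fun h => hy ⟨subset_closure hyD, h⟩)
    · exact indicator_of_notMem hyD _
  have hVK : ∀ y, y ∉ K → V =ᶠ[nhds y] fun _ => 0 := by
    intro y hy
    filter_upwards [hKc.isClosed.isOpen_compl.mem_nhds hy] with z hz using hV0 z hz
  have hVeq : ∀ y ∈ D, V =ᶠ[nhds y] fun z => convexTrunc ε (u z) := by
    intro y hy
    filter_upwards [hDo.mem_nhds hy] with z hz using indicator_of_mem hz _
  have huD : ∀ y ∈ D, ContDiffAt ℝ 2 u y := fun y hy => hu_smooth.contDiffAt (hDo.mem_nhds hy)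
  have hVsm : ContDiff ℝ 2 V := by
    rw [contDiff_iff_contDiffAt]
    intro y
    by_cases hy : y ∈ D
    · exact ((contDiff_convexTrunc ε).contDiffAt.comp y (huD y hy)).congr_of_eventuallyEq
        (hVeq y hy)
    · exact contDiffAt_const.congr_of_eventuallyEq (hVK y fun h => hy (hKD h))
  have hVs : HasCompactSupport V := HasCompactSupport.intro hKc hV0
  have hVg : ∀ y, -lapl V y ≤ g y := by
    intro y
    by_cases hy : y ∈ D
    · rw [lapl_congr (hVeq y hy), hg, indicator_of_mem hy]
      exact neg_lapl_convexTrunc_comp_le hε (huD y hy)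
    · rw [lapl_congr (hVK y fun h => hy (hKD h))]
      simpa [lapl] using hg0 y
  have h := le_of_neg_lapl_le hVsm hVs
    (fun y => indicator_nonneg (fun _ _ => convexTrunc_nonneg hε _) y)
    (fun y hy => indicator_of_notMem hy _) hDm hm hgm hg0 hgA hgi hgM hMpos hApos hMA hVg x
  rw [hV, indicator_of_mem hx] at h
  have := sub_le_convexTrunc hε (u x)
  have : 2 * ε = δ := by rw [hε']; ring
  linarith

lemma abs_le_of_abs_lapl_le (hDo : IsOpen D) (hDb : Bornology.IsBounded D)
    (hu_cont : ContinuousOn u (closure D)) (hu_smooth : ContDiffOn ℝ 2 u D)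
    (hu_bdry : ∀ x ∈ frontier D, u x = 0) (hA : ∀ x ∈ D, |lapl u x| ≤ A) (hApos : 0 < A)
    (hM : ∫ x in D, |lapl u x| = M) (hMpos : 0 < M)
    (hDm : volume D = ENNReal.ofReal m) (hm : 0 < m) {x : Euc2} (hx : x ∈ D) :
    |u x| ≤ M / (4 * Real.pi) * (3 + Real.log (2 * m * A / M)) := by
  refine abs_le'.2 ⟨le_of_abs_lapl_le hDo hDb hu_cont hu_smooth hu_bdry hA hApos hM hMpos hDm hm hx,
    ?_⟩
  exact le_of_abs_lapl_le (u := fun y => -u y) hDo hDb hu_cont.neg hu_smooth.neg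
    (fun y hy => by simp [hu_bdry y hy]) (by simpa only [lapl_neg, abs_neg] using hA) hApos
    (by simpa only [lapl_neg, abs_neg] using hM) hMpos hDm hm hx

lemma setIntegral_abs_lapl_pos (hDo : IsOpen D) (hu_smooth : ContDiffOn ℝ 2 u D)
    (hint : IntegrableOn (fun y => |lapl u y|) D) {x : Euc2} (hx : x ∈ D) (hux : lapl u x ≠ 0) :
    0 < ∫ y in D, |lapl u y| := by
  have hcont : ContinuousOn (lapl u) D := by
    unfold lapl
    refine continuousOn_finsetSum _ fun i _ => ?_
    have h1 : ContDiffOn ℝ 1 (fun y => fderiv ℝ u y (EuclideanSpace.single i 1)) D :=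
      (hu_smooth.fderiv_of_isOpen hDo (by norm_num)).clm_apply contDiffOn_const
    exact (h1.continuousOn_fderiv_of_isOpen hDo le_rfl).clm_apply continuousOn_const
  refine lt_of_le_of_ne (integral_nonneg fun _ => abs_nonneg _) fun h => ?_
  have h0 := (integral_eq_zero_iff_of_nonneg (fun _ => abs_nonneg _) hint).1 h.symm
  have := Measure.eqOn_open_of_ae_eq h0 hDo hcont.abs continuousOn_const hx
  exact hux (abs_eq_zero.1 this)

end Domain

lemma log_two_mul_le_of_pi : 1 + Real.log 2 ≤ (2 * Real.pi - 1) * Real.log Real.pi := by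
  have h3 := Real.pi_gt_three
  have h1 : 1 ≤ Real.log Real.pi := by
    rw [Real.le_log_iff_exp_le Real.pi_pos]
    linarith [Real.exp_one_lt_d9]
  have h2 : Real.log 2 ≤ 1 := by linarith [Real.log_two_lt_d9]
  nlinarith

/-- Brezis-Gallouet-Wainger type estimate in dimension 2:
`‖u‖_∞ ≤ ((1/2)ln π + (1/(2π))(1 + ln R)) ‖Δu‖₁ - (1/(4π)) ‖Δu‖₁ ln(‖Δu‖₁/‖Δu‖_∞)`. -/
theorem linfty_bound_dim_two
    (D : Set Euc2) (hD : D.Nonempty) (hDo : IsOpen D)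
    (hDb : Bornology.IsBounded D) (hDc : IsConnected D)
    (u : Euc2 → ℝ)
    (hu_cont : ContinuousOn u (closure D))
    (hu_smooth : ContDiffOn ℝ 2 u D)
    (hu_bdry : ∀ x ∈ frontier D, u x = 0)
    (hu_lap_bdd : ∃ M : ℝ, ∀ x ∈ D, |lapl u x| ≤ M)
    (hpos : 0 < ⨆ x ∈ D, |lapl u x|)
    (R L1 Linf : ℝ)
    (hR : R = Real.sqrt ((volume D).toReal / Real.pi))
    (hL1 : L1 = ∫ x in D, |lapl u x|)
    (hLinf : Linf = ⨆ x ∈ D, |lapl u x|) :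
    (⨆ x ∈ D, |u x|) ≤
      ((1/2) * Real.log Real.pi + (1/(2 * Real.pi)) * (1 + Real.log R)) * L1
        - (1/(4 * Real.pi)) * L1 * Real.log (L1 / Linf) := by
  have hpi := Real.pi_pos
  obtain ⟨B, hB⟩ := hu_lap_bdd
  have hDfin : volume D < ⊤ := hDb.measure_lt_top
  set m := (volume D).toReal with hm'
  have hDm : volume D = ENNReal.ofReal m := (ENNReal.ofReal_toReal hDfin.ne).symm
  have hm : 0 < m := ENNReal.toReal_pos (hDo.measure_pos volume hD).ne' hDfin.ne
  have hbdd : BddAbove (range fun x => ⨆ (_ : x ∈ D), |lapl u x|) := by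
    refine ⟨max B 0, ?_⟩
    rintro _ ⟨y, rfl⟩
    by_cases hy : y ∈ D
    · simp [hy, hB y hy]
    · simp [hy]
  have hA : ∀ x ∈ D, |lapl u x| ≤ Linf := by
    intro x hx
    have h := le_ciSup hbdd x
    rw [hLinf]
    simpa only [hx, ciSup_pos] using h
  have hApos : 0 < Linf := hLinf ▸ hpos
  obtain ⟨x₀, hx₀, hux₀⟩ : ∃ x ∈ D, lapl u x ≠ 0 := by
    by_contra! hne
    refine hpos.not_ge (Real.iSup_le (fun x => Real.iSup_le (fun hx => ?_) le_rfl) le_rfl)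
    simp [hne x hx]
  have hint : IntegrableOn (fun y => |lapl u y|) D := by
    exact Measure.integrableOn_of_bounded (M := Linf) hDfin.ne
      (measurable_lapl u).abs.aestronglyMeasurable
      ((ae_restrict_iff' hDo.measurableSet).2 <| Eventually.of_forall fun y hy => by
        rw [Real.norm_eq_abs, abs_abs]; exact hA y hy)
  have hMpos : 0 < L1 := hL1 ▸ setIntegral_abs_lapl_pos hDo hu_smooth hint hx₀ hux₀
  have hbound : ∀ x ∈ D, |u x| ≤ L1 / (4 * Real.pi) * (3 + Real.log (2 * m * Linf / L1)) :=
    fun x hx => abs_le_of_abs_lapl_le hDo hDb hu_cont hu_smooth hu_bdry hA hApos hL1.symm hMpos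
      hDm hm hx
  have hR' : Real.log R = (Real.log m - Real.log Real.pi) / 2 := by
    rw [hR, Real.log_sqrt (by positivity), Real.log_div hm.ne' hpi.ne']
  have hlog : Real.log (2 * m * Linf / L1)
      = Real.log 2 + Real.log m - Real.log (L1 / Linf) := by
    rw [Real.log_div (by positivity) hMpos.ne', Real.log_mul (by positivity) hApos.ne',
      Real.log_mul two_ne_zero hm.ne', Real.log_div hMpos.ne' hApos.ne']
    ring
  have hle : L1 / (4 * Real.pi) * (3 + Real.log (2 * m * Linf / L1)) ≤
      ((1/2) * Real.log Real.pi + (1/(2 * Real.pi)) * (1 + Real.log R)) * L1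
        - (1/(4 * Real.pi)) * L1 * Real.log (L1 / Linf) := by
    calc L1 / (4 * Real.pi) * (3 + Real.log (2 * m * Linf / L1))
        ≤ L1 / (4 * Real.pi) * (2 * Real.pi * Real.log Real.pi + 2 + 2 * Real.log R
          - Real.log (L1 / Linf)) := by
          gcongr
          rw [hlog, hR']
          linarith [log_two_mul_le_of_pi]
      _ = _ := by
          field_simp
          ring
  have hnn : 0 ≤ L1 / (4 * Real.pi) * (3 + Real.log (2 * m * Linf / L1)) :=
    (abs_nonneg _).trans (hbound x₀ hx₀)
  exact (Real.iSup_le (fun x => Real.iSup_le (fun hx => hbound x hx) hnn) hnn).trans hle
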